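/- arXiv:2110.02817 — 9 statements merged into one kernel-verified Lean document; each statement's English description precedes it below -/
import Mathlib

section
/- Let U be a reflexive Banach space, U_ad a nonempty, closed, convex subset of U, and let (E_n) be a sequence of functionals E_n : U_ad × U_ad → ℝ ∪ {+∞} that weakly Γ-converges to a functional E : U_ad × U_ad → ℝ ∪ {+∞}. If for each n the point u_n ∈ U_ad is an equilibrium of E_n, and u ∈ U_ad is a weak accumulation point of the sequence (u_n), then u is an equilibrium of E. -/
open Filter Topology

noncomputable section

/-- Weak convergence of a sequence in a normed space, tested against all
continuous linear functionals. -/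
def WeakConv {U : Type*} [NormedAddCommGroup U] [NormedSpace ℝ U]
    (u : ℕ → U) (x : U) : Prop :=
  ∀ f : U →L[ℝ] ℝ, Tendsto (fun n => f (u n)) atTop (𝓝 (f x))

/-- A point `u ∈ U_ad` is an equilibrium of `E : U_ad × U_ad → ℝ ∪ {+∞}` if
`E u u ≤ E v u` for all `v ∈ U_ad`. -/
def IsEquilibrium {U : Type*} [NormedAddCommGroup U] [NormedSpace ℝ U]
    (Uad : Set U) (E : U → U → EReal) (u : U) : Prop :=
  u ∈ Uad ∧ ∀ v ∈ Uad, E u u ≤ E v u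

/-- Weak Γ-convergence of a sequence of equilibrium functionals on `U_ad × U_ad`. -/
def WeakGammaConv {U : Type*} [NormedAddCommGroup U] [NormedSpace ℝ U]
    (Uad : Set U) (En : ℕ → U → U → EReal) (E : U → U → EReal) : Prop :=
  (∀ (u : ℕ → U) (x : U), (∀ n, u n ∈ Uad) → x ∈ Uad → WeakConv u x →
      E x x ≤ liminf (fun n => En n (u n) (u n)) atTop) ∧
  (∀ (u : ℕ → U) (x : U), (∀ n, u n ∈ Uad) → x ∈ Uad → WeakConv u x →
    ∀ v ∈ Uad, ∃ w : ℕ → U, (∀ n, w n ∈ Uad) ∧ WeakConv w v ∧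
      limsup (fun n => En n (w n) (u n)) atTop ≤ E v x)

/-- if `(E_n)` weakly Γ-converges to `E`, `u_n` is an equilibrium of
`E_n` for each `n`, and `u ∈ U_ad` is a weak accumulation point of `(u_n)`, then `u`
is an equilibrium of `E`. The functionals never take the value `⊥` (codomain
`ℝ ∪ {+∞}`), `U` is a reflexive Banach space and `U_ad` a nonempty closed convex
subset. -/
theorem stmt0 {U : Type*} [NormedAddCommGroup U] [NormedSpace ℝ U] [CompleteSpace U]
    (hrefl : Function.Surjective ⇑(NormedSpace.inclusionInDoubleDual ℝ U))
    (Uad : Set U) (hUne : Uad.Nonempty) (hUcl : IsClosed Uad) (hUconv : Convex ℝ Uad)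
    (En : ℕ → U → U → EReal) (E : U → U → EReal)
    (hEnbot : ∀ n, ∀ v u : U, En n v u ≠ ⊥) (hEbot : ∀ v u : U, E v u ≠ ⊥)
    (hΓ : WeakGammaConv Uad En E)
    (u : ℕ → U) (hequi : ∀ n, IsEquilibrium Uad (En n) (u n))
    (x : U) (hx : x ∈ Uad)
    (hacc : ∃ φ : ℕ → ℕ, StrictMono φ ∧ WeakConv (u ∘ φ) x) :
    IsEquilibrium Uad E x := by
  classical
  obtain ⟨φ, hφ, hconv⟩ := hacc
  refine ⟨hx, fun v hv => ?_⟩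
  let z : ℕ → U := fun n => if n ∈ Set.range φ then u n else x
  have hz : ∀ n, z n ∈ Uad := by
    intro n
    by_cases h : n ∈ Set.range φ
    · simp only [z, if_pos h]
      exact (hequi n).1
    · simp only [z, if_neg h]
      exact hx
  have hzφ : ∀ k, z (φ k) = u (φ k) := fun k => if_pos ⟨k, rfl⟩
  have hzc : WeakConv z x := by
    intro f s hs
    obtain ⟨K, hK⟩ := eventually_atTop.1 ((hconv f).eventually hs)
    refine mem_map.2 (mem_atTop_sets.2 ⟨φ K, fun n hn => ?_⟩)
    by_cases h : n ∈ Set.range φ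
    · obtain ⟨k, rfl⟩ := h
      have h2 := hK k (hφ.le_iff_le.1 hn)
      show f (z (φ k)) ∈ s
      rw [hzφ]
      exact h2
    · show f (z n) ∈ s
      simp only [z, if_neg h]
      exact mem_of_mem_nhds hs
  obtain ⟨w, hw, -, hlim⟩ := hΓ.2 z x hz hx hzc v hv
  refine (hΓ.1 z x hz hx hzc).trans (le_trans ?_ hlim)
  refine liminf_le_limsup_of_frequently_le ?_
  refine frequently_atTop.2 fun N => ⟨φ N, hφ.le_apply, ?_⟩
  rw [hzφ]
  exact (hequi (φ N)).2 _ (hw _)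
end
end

section
/- Let Z be a real Hilbert space, U a reflexive Banach space, and H : Z × U → ℝ ∪ {+∞} a functional that is bounded from below and such that: (a) for all sequences z_n ⇀ z in Z and u_n ⇀ u in U one has H(z,u) ≤ liminf_n H(z_n,u_n); (b) for every sequence u_n ⇀ u in U and every z ∈ Z there exists a sequence z_n → z strongly in Z with limsup_n H(z_n,u_n) ≤ H(z,u). Then for every sequence u_n ⇀ u in U and all positive reals λ_n → λ > 0 the following hold: for every z_n ⇀ z in Z, MY(λ, H(·,u))(z) ≤ liminf_n MY(λ_n, H(·,u_n))(z_n); and for every z_n → z strongly in Z, limsup_n MY(λ_n, H(·,u_n))(z_n) ≤ MY(λ, H(·,u))(z). -/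
open Filter Topology

noncomputable section

/-- The Moreau–Yosida regularization
`MY γ H z = inf_{ζ} ( H ζ + (γ/2) ‖ζ - z‖² )`. -/
def MY {Z : Type*} [NormedAddCommGroup Z] (γ : ℝ) (H : Z → EReal) (z : Z) : EReal :=
  ⨅ ζ : Z, H ζ + ((γ / 2 * ‖ζ - z‖ ^ 2 : ℝ) : EReal)

theorem exists_weak_subseq {Z : Type*}
    [NormedAddCommGroup Z] [InnerProductSpace ℝ Z] [CompleteSpace Z]
    (d : ℕ → Z) (C : ℝ) (hd : ∀ n, ‖d n‖ ≤ C) :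
    ∃ (w : Z) (ψ : ℕ → ℕ), StrictMono ψ ∧ WeakConv (fun n => d (ψ n)) w := by
  let K : Submodule ℝ Z := (Submodule.span ℝ (Set.range d)).topologicalClosure
  have hdK : ∀ n, d n ∈ K := fun n =>
    Submodule.le_topologicalClosure _ (Submodule.subset_span ⟨n, rfl⟩)
  have hclosed : IsClosed (K : Set Z) := Submodule.isClosed_topologicalClosure _
  have : CompleteSpace K := hclosed.completeSpace_coe
  have hsepset : TopologicalSpace.IsSeparable (K : Set Z) := by
    have h1 : TopologicalSpace.IsSeparable (Set.range d) := (Set.countable_range d).isSeparable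
    have h2 := (h1.span (R := ℝ)).closure
    simpa [K, Submodule.topologicalClosure_coe] using h2
  have : TopologicalSpace.SeparableSpace K := hsepset.separableSpace
  let e : ℕ → K := fun n => ⟨d n, hdK n⟩
  have hseq := WeakDual.isSeqCompact_closedBall ℝ K (0 : StrongDual ℝ K) C
  obtain ⟨g, -, ψ, hψ, hlim⟩ := hseq
    (x := fun n => StrongDual.toWeakDual (InnerProductSpace.toDual ℝ K (e n))) (by
      intro n
      have : ‖InnerProductSpace.toDual ℝ K (e n)‖ ≤ C := by
        rw [LinearIsometryEquiv.norm_map]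
        exact hd n
      simpa using this)
  let w : K := (InnerProductSpace.toDual ℝ K).symm (WeakDual.toStrongDual g)
  refine ⟨(w : Z), ψ, hψ, ?_⟩
  intro f
  have hp : ∀ v : K, Tendsto (fun n => inner ℝ (e (ψ n)) v) atTop (𝓝 (inner ℝ w v)) := by
    intro v
    have h1 := ((WeakDual.eval_continuous v).tendsto g).comp hlim
    have h2 : inner ℝ w v = g v := InnerProductSpace.toDual_symm_apply
    rw [h2]
    exact h1
  have hf : ∀ v : K, f (v : Z) =
      inner ℝ v ((InnerProductSpace.toDual ℝ K).symm (f.comp K.subtypeL)) := by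
    intro v
    rw [real_inner_comm, InnerProductSpace.toDual_symm_apply]
    rfl
  have h := hp ((InnerProductSpace.toDual ℝ K).symm (f.comp K.subtypeL))
  rw [← hf] at h
  refine h.congr fun n => ?_
  rw [← hf]

/-- stability of the Moreau–Yosida regularization of a jointly
sequentially weakly lsc functional with feedback component, under `λ_n → λ` and
weak/strong convergence of the arguments. -/
theorem stmt2 {Z U : Type*}
    [NormedAddCommGroup Z] [InnerProductSpace ℝ Z] [CompleteSpace Z]
    [NormedAddCommGroup U] [NormedSpace ℝ U] [CompleteSpace U]
    (hrefl : Function.Surjective ⇑(NormedSpace.inclusionInDoubleDual ℝ U))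
    (H : Z → U → EReal)
    (hbot : ∀ z u, H z u ≠ ⊥)
    (hbdd : ∃ c : ℝ, ∀ z u, (c : EReal) ≤ H z u)
    (ha : ∀ (z : ℕ → Z) (z₀ : Z) (u : ℕ → U) (u₀ : U), WeakConv z z₀ → WeakConv u u₀ →
      H z₀ u₀ ≤ liminf (fun n => H (z n) (u n)) atTop)
    (hb : ∀ (u : ℕ → U) (u₀ : U), WeakConv u u₀ → ∀ z₀ : Z, ∃ z : ℕ → Z,
      Tendsto z atTop (𝓝 z₀) ∧ limsup (fun n => H (z n) (u n)) atTop ≤ H z₀ u₀)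
    (u : ℕ → U) (u₀ : U) (hu : WeakConv u u₀)
    (lam : ℕ → ℝ) (l : ℝ) (hlampos : ∀ n, 0 < lam n) (hlpos : 0 < l)
    (hlam : Tendsto lam atTop (𝓝 l)) :
    (∀ (z : ℕ → Z) (z₀ : Z), WeakConv z z₀ →
      MY l (fun ζ => H ζ u₀) z₀ ≤
        liminf (fun n => MY (lam n) (fun ζ => H ζ (u n)) (z n)) atTop) ∧
    (∀ (z : ℕ → Z) (z₀ : Z), Tendsto z atTop (𝓝 z₀) →
      limsup (fun n => MY (lam n) (fun ζ => H ζ (u n)) (z n)) atTop ≤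
        MY l (fun ζ => H ζ u₀) z₀) := by
  obtain ⟨c, hc⟩ := hbdd
  constructor
  · intro z z₀ hz
    by_contra hcon
    rw [not_le] at hcon
    obtain ⟨a, ha1, ha2⟩ := EReal.lt_iff_exists_real_btwn.1 hcon
    have hfr := frequently_lt_of_liminf_lt (h := ha1)
    have hev : ∀ᶠ n in atTop, l / 2 < lam n := hlam.eventually (lt_mem_nhds (by linarith))
    obtain ⟨φ, hφ, hP⟩ := extraction_of_frequently_atTop (hfr.and_eventually hev)
    have hex : ∀ n, ∃ ζ : Z, H ζ (u (φ n)) +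
        ((lam (φ n) / 2 * ‖ζ - z (φ n)‖ ^ 2 : ℝ) : EReal) < a := fun n =>
      iInf_lt_iff.1 (hP n).1
    choose ζ hζ using hex
    have hbd : ∀ n, lam (φ n) / 2 * ‖ζ n - z (φ n)‖ ^ 2 ≤ a - c := by
      intro n
      have h1 : ((c + lam (φ n) / 2 * ‖ζ n - z (φ n)‖ ^ 2 : ℝ) : EReal) < a := by
        rw [EReal.coe_add]
        exact lt_of_le_of_lt (add_le_add_left (hc _ _) _) (hζ n)
      have := EReal.coe_lt_coe_iff.1 h1
      linarith
    obtain ⟨w, ψ, hψ, hw⟩ := exists_weak_subseq (fun n => ζ n - z (φ n))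
      (1 + 4 * (a - c) / l) (by
        intro n
        have h1 := hbd n
        have h2 := (hP n).2
        have h3 : ‖ζ n - z (φ n)‖ ^ 2 ≤ 4 * (a - c) / l := by
          rw [le_div_iff₀ hlpos]
          nlinarith [sq_nonneg ‖ζ n - z (φ n)‖]
        nlinarith [sq_nonneg (‖ζ n - z (φ n)‖ - 1)])
    have hφψ : Tendsto (fun n => φ (ψ n)) atTop atTop :=
      hφ.tendsto_atTop.comp hψ.tendsto_atTop
    have hζw : WeakConv (fun n => ζ (ψ n)) (w + z₀) := by
      intro f
      have h1 := (hw f).add ((hz f).comp hφψ)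
      rw [map_add]
      refine h1.congr fun n => ?_
      simp
    have huw : WeakConv (fun n => u (φ (ψ n))) u₀ := fun f => (hu f).comp hφψ
    have hH := ha _ _ _ _ hζw huw
    have hin : Tendsto (fun n => inner ℝ w (ζ (ψ n) - z (φ (ψ n)))) atTop (𝓝 (inner ℝ w w)) :=
      hw (innerSL ℝ w)
    have hr : Tendsto (fun n => a - lam (φ (ψ n)) / 2 *
        (2 * inner ℝ w (ζ (ψ n) - z (φ (ψ n))) - ‖w‖ ^ 2)) atTop
        (𝓝 (a - l / 2 * (2 * inner ℝ w w - ‖w‖ ^ 2))) :=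
      tendsto_const_nhds.sub (((hlam.comp hφψ).div_const 2).mul
        ((hin.const_mul 2).sub tendsto_const_nhds))
    rw [real_inner_self_eq_norm_sq] at hr
    have hrE := (continuous_coe_real_ereal.tendsto _).comp hr
    have hle : ∀ n, H (ζ (ψ n)) (u (φ (ψ n))) ≤ ((a - lam (φ (ψ n)) / 2 *
        (2 * inner ℝ w (ζ (ψ n) - z (φ (ψ n))) - ‖w‖ ^ 2) : ℝ) : EReal) := by
      intro n
      have h1 := hζ (ψ n)
      set d := ζ (ψ n) - z (φ (ψ n)) with hd
      have h2 : 2 * inner ℝ w d - ‖w‖ ^ 2 ≤ ‖d‖ ^ 2 := by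
        have := norm_sub_sq_real w d
        nlinarith [sq_nonneg ‖w - d‖]
      have h3 : H (ζ (ψ n)) (u (φ (ψ n))) ≤
          ((a - lam (φ (ψ n)) / 2 * ‖d‖ ^ 2 : ℝ) : EReal) := by
        rw [EReal.coe_sub]
        exact EReal.le_sub_iff_add_le (.inl (EReal.coe_ne_bot _))
          (.inl (EReal.coe_ne_top _)) |>.2 h1.le
      refine h3.trans (EReal.coe_le_coe_iff.2 ?_)
      have := hlampos (φ (ψ n))
      nlinarith
    have hlim : H (w + z₀) u₀ ≤ ((a - l / 2 * ‖w‖ ^ 2 : ℝ) : EReal) := by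
      refine hH.trans ?_
      refine (liminf_le_liminf (Eventually.of_forall hle)).trans ?_
      have := hrE.liminf_eq
      simp only [Function.comp_def] at this
      rw [this]
      apply le_of_eq
      congr 1
      ring
    refine absurd ha2 (not_lt.2 ?_)
    refine (iInf_le _ (w + z₀)).trans ?_
    refine (add_le_add_left hlim _).trans ?_
    rw [← EReal.coe_add, add_sub_cancel_right]
    apply le_of_eq
    congr 1
    ring
  · intro z z₀ hz
    refine le_iInf fun ζ₀ => ?_
    obtain ⟨ζ, hζ, hlim⟩ := hb u u₀ hu ζ₀
    have hq : Tendsto (fun n => lam n / 2 * ‖ζ n - z n‖ ^ 2) atTop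
        (𝓝 (l / 2 * ‖ζ₀ - z₀‖ ^ 2)) :=
      (hlam.div_const 2).mul ((hζ.sub hz).norm.pow 2)
    have hqE : limsup (fun n => ((lam n / 2 * ‖ζ n - z n‖ ^ 2 : ℝ) : EReal)) atTop =
        ((l / 2 * ‖ζ₀ - z₀‖ ^ 2 : ℝ) : EReal) :=
      ((continuous_coe_real_ereal.tendsto _).comp hq).limsup_eq
    calc limsup (fun n => MY (lam n) (fun ζ => H ζ (u n)) (z n)) atTop
        ≤ limsup ((fun n => H (ζ n) (u n)) +
          (fun n => ((lam n / 2 * ‖ζ n - z n‖ ^ 2 : ℝ) : EReal))) atTop :=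
        limsup_le_limsup (Eventually.of_forall fun n => iInf_le _ (ζ n))
      _ ≤ _ := EReal.limsup_add_le (.inr (by rw [hqE]; exact EReal.coe_ne_top _))
          (.inr (by rw [hqE]; exact EReal.coe_ne_bot _))
      _ ≤ _ := by
        rw [hqE]
        exact add_le_add_left hlim _
end
end

section
/- Let Z be a real Hilbert space, U a reflexive Banach space, and H : Z × U → ℝ ∪ {+∞} a functional that is bounded from below and such that: (a) for all sequences z_n ⇀ z in Z and u_n ⇀ u in U one has H(z,u) ≤ liminf_n H(z_n,u_n); (b) for every sequence u_n ⇀ u in U and every z ∈ Z there exists a sequence z_n → z strongly in Z with limsup_n H(z_n,u_n) ≤ H(z,u). Then for every sequence of positive reals γ_n → ∞ and every sequence u_n ⇀ u in U, the sequence of functionals MY(γ_n, H(·,u_n)) Mosco-converges to H(·,u). -/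
open Filter Topology

noncomputable section

/-- Mosco convergence of a sequence of functionals `H_n` to `H`. -/
def Mosco {Z : Type*} [NormedAddCommGroup Z] [NormedSpace ℝ Z]
    (Hn : ℕ → Z → EReal) (H : Z → EReal) : Prop :=
  (∀ (z : ℕ → Z) (z₀ : Z), WeakConv z z₀ →
      H z₀ ≤ liminf (fun n => Hn n (z n)) atTop) ∧
  (∀ z₀ : Z, ∃ z : ℕ → Z, Tendsto z atTop (𝓝 z₀) ∧
      limsup (fun n => Hn n (z n)) atTop ≤ H z₀)

/-- for a functional `H` with feedback component, bounded from below and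
satisfying the weak lower limit and strong recovery conditions, and for positive
`γ_n → ∞` and `u_n ⇀ u`, the Moreau–Yosida regularizations `MY (γ n) (H ·, u_n)`
Mosco-converge to `H(·,u)`. -/
theorem stmt3 {Z U : Type*}
    [NormedAddCommGroup Z] [InnerProductSpace ℝ Z] [CompleteSpace Z]
    [NormedAddCommGroup U] [NormedSpace ℝ U] [CompleteSpace U]
    (hrefl : Function.Surjective ⇑(NormedSpace.inclusionInDoubleDual ℝ U))
    (H : Z → U → EReal)
    (hbot : ∀ z u, H z u ≠ ⊥)
    (hbdd : ∃ c : ℝ, ∀ z u, (c : EReal) ≤ H z u)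
    (ha : ∀ (z : ℕ → Z) (z₀ : Z) (u : ℕ → U) (u₀ : U), WeakConv z z₀ → WeakConv u u₀ →
      H z₀ u₀ ≤ liminf (fun n => H (z n) (u n)) atTop)
    (hb : ∀ (u : ℕ → U) (u₀ : U), WeakConv u u₀ → ∀ z₀ : Z, ∃ z : ℕ → Z,
      Tendsto z atTop (𝓝 z₀) ∧ limsup (fun n => H (z n) (u n)) atTop ≤ H z₀ u₀)
    (γ : ℕ → ℝ) (hγpos : ∀ n, 0 < γ n) (hγ : Tendsto γ atTop atTop)
    (u : ℕ → U) (u₀ : U) (hu : WeakConv u u₀) :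
    Mosco (fun n => MY (γ n) (fun ζ => H ζ (u n))) (fun ζ => H ζ u₀) := by
  obtain ⟨c, hc⟩ := hbdd
  refine ⟨?_, ?_⟩
  · intro z z₀ hz
    by_contra hlt
    rw [not_le] at hlt
    obtain ⟨a, ha1, ha2⟩ := EReal.lt_iff_exists_real_btwn.1 hlt
    have hfr : ∃ᶠ n in atTop, MY (γ n) (fun ζ => H ζ (u n)) (z n) < (a : EReal) :=
      frequently_lt_of_liminf_lt (by isBoundedDefault) ha1
    obtain ⟨φ, hφ, hφa⟩ := extraction_of_frequently_atTop hfr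
    have hex : ∀ k, ∃ ζ : Z, H ζ (u (φ k)) +
        ((γ (φ k) / 2 * ‖ζ - z (φ k)‖ ^ 2 : ℝ) : EReal) < (a : EReal) := fun k =>
      iInf_lt_iff.1 (hφa k)
    choose ζ hζ using hex
    have hnn : ∀ k, 0 ≤ γ (φ k) / 2 * ‖ζ k - z (φ k)‖ ^ 2 := fun k => by
      have := (hγpos (φ k)).le
      positivity
    have hH : ∀ k, H (ζ k) (u (φ k)) ≤ (a : EReal) := fun k => by
      refine le_trans ?_ (hζ k).le
      exact le_add_of_nonneg_right (EReal.coe_nonneg.2 (hnn k))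
    have hd : ∀ k, c + γ (φ k) / 2 * ‖ζ k - z (φ k)‖ ^ 2 < a := fun k => by
      have h1 : (c : EReal) + ((γ (φ k) / 2 * ‖ζ k - z (φ k)‖ ^ 2 : ℝ) : EReal) < a :=
        lt_of_le_of_lt (add_le_add_left (hc _ _) _) (hζ k)
      exact_mod_cast h1
    have hγφ : Tendsto (fun k => γ (φ k)) atTop atTop := hγ.comp hφ.tendsto_atTop
    have hsq : Tendsto (fun k => ‖ζ k - z (φ k)‖ ^ 2) atTop (𝓝 0) := by
      refine squeeze_zero (fun k => by positivity) (fun k => ?_)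
        (hγφ.const_div_atTop (2 * (a - c)))
      rw [le_div_iff₀ (hγpos _)]
      nlinarith [hd k]
    have hn : Tendsto (fun k => ‖ζ k - z (φ k)‖) atTop (𝓝 0) := by
      have := hsq.sqrt
      simpa using this
    have h0 : Tendsto (fun k => ζ k - z (φ k)) atTop (𝓝 0) :=
      tendsto_zero_iff_norm_tendsto_zero.2 hn
    have hwz : WeakConv ζ z₀ := fun f => by
      have h1 := (f.continuous.tendsto 0).comp h0
      have h2 := h1.add ((hz f).comp hφ.tendsto_atTop)
      simpa [Function.comp_def] using h2
    have hwu : WeakConv (fun k => u (φ k)) u₀ := fun f => (hu f).comp hφ.tendsto_atTop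
    have h3 := ha ζ z₀ _ u₀ hwz hwu
    have h4 : liminf (fun k => H (ζ k) (u (φ k))) atTop ≤ (a : EReal) := by
      have := liminf_le_liminf (f := atTop) (Eventually.of_forall hH)
        (by isBoundedDefault) (by isBoundedDefault)
      simpa using this
    exact absurd (h3.trans h4) (not_le.2 ha2)
  · intro z₀
    obtain ⟨z, hz, hl⟩ := hb u u₀ hu z₀
    refine ⟨z, hz, le_trans ?_ hl⟩
    refine limsup_le_limsup (Eventually.of_forall fun n => ?_)
      (by isBoundedDefault) (by isBoundedDefault)
    refine (iInf_le _ (z n)).trans ?_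
    simp
end
end

section
/- Let U, Y be reflexive Banach spaces, Z a real Hilbert space, U_ad ⊆ U nonempty, closed, convex, and A : U → Y, B : U → Z bounded linear operators. Let F : U_ad × U_ad → ℝ ∪ {+∞} and G : Y × U_ad → ℝ ∪ {+∞} be proper, convex, lower semicontinuous in the control component and satisfy: for all sequences u_n ⇀ u in U_ad and v_n → v strongly, F(u,u) ≤ liminf_n F(u_n,u_n), limsup_n F(v_n,u_n) ≤ F(v,u), G(Au,u) ≤ liminf_n G(Au_n,u_n), limsup_n G(Av_n,u_n) ≤ G(Av,u). Let H : Z → ℝ ∪ {+∞} be proper, convex, lower semicontinuous (independent of the feedback component). Define E(v,u) := F(v,u) + G(Av,u) + H(Bv) and, for a sequence of positive reals γ_n → ∞, E_n(v,u) := F(v,u) + G(Av,u) + MY(γ_n, H)(Bv). Then (E_n) Mosco-converges to E. -/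
open Filter Topology

noncomputable section

/-- Convexity of an `EReal`-valued functional. -/
def ConvexE {X : Type*} [AddCommGroup X] [Module ℝ X] (f : X → EReal) : Prop :=
  ∀ x y : X, ∀ t : ℝ, 0 ≤ t → t ≤ 1 →
    f (t • x + (1 - t) • y) ≤ (t : EReal) * f x + ((1 - t : ℝ) : EReal) * f y

/-- Mosco convergence of a sequence of equilibrium functionals on `U_ad × U_ad`:
the weak lower limit inequality along the diagonal and strong recovery sequences. -/
def MoscoBiv {U : Type*} [NormedAddCommGroup U] [NormedSpace ℝ U]
    (Uad : Set U) (En : ℕ → U → U → EReal) (E : U → U → EReal) : Prop :=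
  (∀ (u : ℕ → U) (x : U), (∀ n, u n ∈ Uad) → x ∈ Uad → WeakConv u x →
      E x x ≤ liminf (fun n => En n (u n) (u n)) atTop) ∧
  (∀ (u : ℕ → U) (x : U), (∀ n, u n ∈ Uad) → x ∈ Uad → WeakConv u x →
    ∀ v ∈ Uad, ∃ w : ℕ → U, (∀ n, w n ∈ Uad) ∧ Tendsto w atTop (𝓝 v) ∧
      limsup (fun n => En n (w n) (u n)) atTop ≤ E v x)

lemma aux_sep {Z : Type*} [NormedAddCommGroup Z] [NormedSpace ℝ Z] {H : Z → EReal}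
    (hHproper : ∃ z, H z ≠ ⊤) (hHbot : ∀ z, H z ≠ ⊥)
    (hHconv : ConvexE H) (hHlsc : LowerSemicontinuous H) (z : Z) (c : ℝ) (hc : (c : EReal) < H z) :
    ∃ (g : Z →L[ℝ] ℝ) (a s : ℝ), 0 ≤ a ∧ g z + a * c < s ∧
      ∀ (ζ : Z) (t : ℝ), H ζ ≤ (t : EReal) → s < g ζ + a * t := by
  have hcl : IsClosed {p : Z × ℝ | H p.1 ≤ (p.2 : EReal)} := by
    have h1 := hHlsc.isClosed_epigraph
    have h2 : Continuous (fun p : Z × ℝ => (p.1, (p.2 : EReal))) :=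
      continuous_fst.prodMk (continuous_coe_real_ereal.comp continuous_snd)
    exact h1.preimage h2
  have hcv : Convex ℝ {p : Z × ℝ | H p.1 ≤ (p.2 : EReal)} := by
    rintro ⟨x, r⟩ hx ⟨y, q⟩ hy a b ha hb hab
    obtain rfl : b = 1 - a := by linarith
    simp only [Set.mem_ofPred_eq] at hx hy
    have h := hHconv x y a ha (by linarith)
    show H (a • x + (1 - a) • y) ≤ ((a * r + (1 - a) * q : ℝ) : EReal)
    refine h.trans ?_
    rw [EReal.coe_add, EReal.coe_mul, EReal.coe_mul]
    exact add_le_add (mul_le_mul_of_nonneg_left hx (EReal.coe_nonneg.2 ha))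
      (mul_le_mul_of_nonneg_left hy (EReal.coe_nonneg.2 hb))
  obtain ⟨f, s, hs, hf⟩ := geometric_hahn_banach_point_closed hcv hcl
    (x := (z, c)) (by simpa using hc)
  have hdec : ∀ (ζ : Z) (t : ℝ), f (ζ, t) = f (ζ, 0) + f (0, 1) * t := by
    intro ζ t
    have : ((ζ, t) : Z × ℝ) = (ζ, 0) + t • ((0 : Z), (1 : ℝ)) := by simp
    rw [this, map_add, map_smul, smul_eq_mul, mul_comm]
  have hf' : ∀ (ζ : Z) (t : ℝ), H ζ ≤ (t : EReal) → s < f (ζ, 0) + f (0, 1) * t := by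
    intro ζ t h
    rw [← hdec]; exact hf _ h
  refine ⟨f.comp (ContinuousLinearMap.inl ℝ Z ℝ), f (0, 1), s, ?_, ?_, ?_⟩
  · by_contra hneg
    push Not at hneg
    obtain ⟨z0, hz0⟩ := hHproper
    have h0 := EReal.coe_toReal hz0 (hHbot z0)
    set r := (H z0).toReal
    have := hf' z0 (max r ((s - f (z0, 0)) / f (0, 1)))
      (by rw [← h0]; exact EReal.coe_le_coe_iff.2 (le_max_left _ _))
    have h2 := mul_le_mul_of_nonpos_left (le_max_right r ((s - f (z0, 0)) / f (0, 1))) hneg.le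
    rw [mul_div_cancel₀ _ hneg.ne] at h2
    linarith
  · simpa [← hdec] using hs
  · intro ζ t h
    simpa using hf' ζ t h

lemma aux_affine_pos {Z : Type*} [NormedAddCommGroup Z] [NormedSpace ℝ Z] {H : Z → EReal}
    (hHbot : ∀ z, H z ≠ ⊥) (z : Z) (c : ℝ) (g : Z →L[ℝ] ℝ) (a s : ℝ) (ha : 0 < a)
    (h1 : g z + a * c < s) (h2 : ∀ (ζ : Z) (t : ℝ), H ζ ≤ (t : EReal) → s < g ζ + a * t) :
    ∃ (g : Z →L[ℝ] ℝ) (b : ℝ), (∀ ζ, ((g ζ + b : ℝ) : EReal) ≤ H ζ) ∧ c < g z + b := by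
  refine ⟨(-a⁻¹) • g, s / a, ?_, ?_⟩
  · intro ζ
    by_cases ht : H ζ = ⊤
    · rw [ht]; exact le_top
    have h0 := EReal.coe_toReal ht (hHbot ζ)
    have h3 := h2 ζ _ h0.ge
    rw [← h0]
    refine EReal.coe_le_coe_iff.2 ?_
    have : ((-a⁻¹) • g) ζ + s / a = (s - g ζ) / a := by
      simp; field_simp; ring
    rw [this, div_le_iff₀ ha]
    linarith
  · have : ((-a⁻¹) • g) z + s / a = (s - g z) / a := by
      simp; field_simp; ring
    rw [this, lt_div_iff₀ ha]
    linarith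

lemma aux_affine {Z : Type*} [NormedAddCommGroup Z] [NormedSpace ℝ Z] {H : Z → EReal}
    (hHproper : ∃ z, H z ≠ ⊤) (hHbot : ∀ z, H z ≠ ⊥)
    (hHconv : ConvexE H) (hHlsc : LowerSemicontinuous H) (z : Z) (c : ℝ) (hc : (c : EReal) < H z) :
    ∃ (g : Z →L[ℝ] ℝ) (b : ℝ), (∀ ζ, ((g ζ + b : ℝ) : EReal) ≤ H ζ) ∧ c < g z + b := by
  obtain ⟨g, a, s, ha, h1, h2⟩ := aux_sep hHproper hHbot hHconv hHlsc z c hc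
  rcases ha.lt_or_eq with ha | rfl
  · exact aux_affine_pos hHbot z c g a s ha h1 h2
  simp only [zero_mul, add_zero] at h1 h2
  obtain ⟨g0, b0, h3⟩ : ∃ (g : Z →L[ℝ] ℝ) (b : ℝ), (∀ ζ, ((g ζ + b : ℝ) : EReal) ≤ H ζ) := by
    obtain ⟨z0, hz0⟩ := hHproper
    have h0 := EReal.coe_toReal hz0 (hHbot z0)
    set r := (H z0).toReal
    have hlt : ((r - 1 : ℝ) : EReal) < H z0 := by
      rw [← h0]; exact EReal.coe_lt_coe_iff.2 (by linarith)
    obtain ⟨g', a', s', ha', h1', h2'⟩ := aux_sep ⟨z0, hz0⟩ hHbot hHconv hHlsc z0 _ hlt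
    have h4 := h2' z0 r h0.ge
    obtain ⟨g'', b'', h5, -⟩ := aux_affine_pos hHbot z0 _ g' a' s' (by linarith) h1' h2'
    exact ⟨g'', b'', h5⟩
  have hpos : 0 < s - g z := by linarith
  obtain ⟨k, hk⟩ := exists_nat_gt ((c - (g0 z + b0)) / (s - g z))
  rw [div_lt_iff₀ hpos] at hk
  refine ⟨g0 - (k : ℝ) • g, b0 + k * s, ?_, ?_⟩
  · intro ζ
    by_cases ht : H ζ = ⊤
    · rw [ht]; exact le_top
    have h0 := EReal.coe_toReal ht (hHbot ζ)
    have h4 := h2 ζ _ h0.ge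
    refine le_trans (EReal.coe_le_coe_iff.2 ?_) (h3 ζ)
    have : (k : ℝ) * s ≤ k * g ζ := by gcongr
    simp
    linarith
  · simp
    linarith

lemma aux_MY_ge {Z : Type*} [NormedAddCommGroup Z] [NormedSpace ℝ Z] {H : Z → EReal}
    (g : Z →L[ℝ] ℝ) (b : ℝ) (h : ∀ ζ, ((g ζ + b : ℝ) : EReal) ≤ H ζ) (γ : ℝ) (hγ : 0 < γ) (z : Z) :
    ((g z + b - ‖g‖ ^ 2 / (2 * γ) : ℝ) : EReal) ≤ MY γ H z := by
  refine le_iInf fun ζ => ?_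
  refine le_trans ?_ (add_le_add_left (h ζ) _)
  rw [← EReal.coe_add]
  refine EReal.coe_le_coe_iff.2 ?_
  have h1 : g (ζ - z) = g ζ - g z := map_sub _ _ _
  have h2 := g.le_opNorm (ζ - z)
  rw [Real.norm_eq_abs, h1] at h2
  have h3 := (abs_le.1 h2).1
  have h4 : ‖g‖ * ‖ζ - z‖ ≤ γ / 2 * ‖ζ - z‖ ^ 2 + ‖g‖ ^ 2 / (2 * γ) := by
    have : γ / 2 * ‖ζ - z‖ ^ 2 + ‖g‖ ^ 2 / (2 * γ) - ‖g‖ * ‖ζ - z‖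
        = (γ * ‖ζ - z‖ - ‖g‖) ^ 2 / (2 * γ) := by
      field_simp; ring
    have : 0 ≤ (γ * ‖ζ - z‖ - ‖g‖) ^ 2 / (2 * γ) := by positivity
    linarith
  linarith

lemma aux_MY_le {Z : Type*} [NormedAddCommGroup Z] (H : Z → EReal) (γ : ℝ) (z : Z) :
    MY γ H z ≤ H z := by
  refine (iInf_le _ z).trans ?_
  simp

lemma aux_MY_liminf {Z : Type*} [NormedAddCommGroup Z] [NormedSpace ℝ Z] {H : Z → EReal}
    (hHproper : ∃ z, H z ≠ ⊤) (hHbot : ∀ z, H z ≠ ⊥)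
    (hHconv : ConvexE H) (hHlsc : LowerSemicontinuous H)
    (γ : ℕ → ℝ) (hγpos : ∀ n, 0 < γ n) (hγ : Tendsto γ atTop atTop)
    (u : ℕ → Z) (z : Z) (hu : WeakConv u z) :
    H z ≤ liminf (fun n => MY (γ n) H (u n)) atTop := by
  refine EReal.ge_of_forall_gt_iff_ge.1 fun c hc => ?_
  obtain ⟨g, b, h1, h2⟩ := aux_affine hHproper hHbot hHconv hHlsc z c hc
  refine le_liminf_of_le (by isBoundedDefault) ?_
  have h3 : Tendsto (fun n => g (u n) + b - ‖g‖ ^ 2 / (2 * γ n)) atTop (𝓝 (g z + b - 0)) := by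
    refine ((hu g).add_const b).sub ?_
    exact Tendsto.const_div_atTop (hγ.const_mul_atTop two_pos) _
  rw [sub_zero] at h3
  filter_upwards [h3.eventually_const_lt h2] with n hn
  exact (EReal.coe_le_coe_iff.2 hn.le).trans (aux_MY_ge g b h1 (γ n) (hγpos n) (u n))

lemma aux_limsup_add {a b : ℕ → EReal} {x y : EReal} (hx : x ≠ ⊥) (hy : y ≠ ⊥)
    (ha : limsup a atTop ≤ x) (hb : limsup b atTop ≤ y) :
    limsup (fun n => a n + b n) atTop ≤ x + y := by
  by_cases h1 : x = ⊤
  · rw [h1, EReal.top_add_of_ne_bot hy]; exact le_top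
  by_cases h2 : y = ⊤
  · rw [h2, EReal.add_top_of_ne_bot hx]; exact le_top
  exact (EReal.limsup_add_le (.inr (hb.trans_lt (lt_top_iff_ne_top.2 h2)).ne)
    (.inl (ha.trans_lt (lt_top_iff_ne_top.2 h1)).ne)).trans (add_le_add ha hb)

/-- Mosco convergence of the Moreau–Yosida regularized equilibrium
functionals when the non-smooth part `H` does not depend on the feedback
component. -/
theorem stmt5 {U Y Z : Type*}
    [NormedAddCommGroup U] [NormedSpace ℝ U] [CompleteSpace U]
    [NormedAddCommGroup Y] [NormedSpace ℝ Y] [CompleteSpace Y]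
    [NormedAddCommGroup Z] [InnerProductSpace ℝ Z] [CompleteSpace Z]
    (hreflU : Function.Surjective ⇑(NormedSpace.inclusionInDoubleDual ℝ U))
    (hreflY : Function.Surjective ⇑(NormedSpace.inclusionInDoubleDual ℝ Y))
    (Uad : Set U) (hUne : Uad.Nonempty) (hUcl : IsClosed Uad) (hUconv : Convex ℝ Uad)
    (A : U →L[ℝ] Y) (B : U →L[ℝ] Z)
    (F : U → U → EReal) (G : Y → U → EReal) (H : Z → EReal)
    -- `F` is proper, convex and lsc in the control component
    (hFbot : ∀ v u, F v u ≠ ⊥)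
    (hFproper : ∀ u ∈ Uad, ∃ v, F v u ≠ ⊤)
    (hFconv : ∀ u ∈ Uad, ∀ x ∈ Uad, ∀ y ∈ Uad, ∀ t : ℝ, 0 ≤ t → t ≤ 1 →
      F (t • x + (1 - t) • y) u ≤ (t : EReal) * F x u + ((1 - t : ℝ) : EReal) * F y u)
    (hFlsc : ∀ u ∈ Uad, LowerSemicontinuous fun v => F v u)
    -- `G` is proper, convex and lsc in the control component
    (hGbot : ∀ y u, G y u ≠ ⊥)
    (hGproper : ∀ u ∈ Uad, ∃ y, G y u ≠ ⊤)
    (hGconv : ∀ u ∈ Uad, ∀ x y : Y, ∀ t : ℝ, 0 ≤ t → t ≤ 1 →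
      G (t • x + (1 - t) • y) u ≤ (t : EReal) * G x u + ((1 - t : ℝ) : EReal) * G y u)
    (hGlsc : ∀ u ∈ Uad, LowerSemicontinuous fun y => G y u)
    -- sequential semicontinuity conditions on `F` and `G`
    (hF1 : ∀ (u : ℕ → U) (u₀ : U), (∀ n, u n ∈ Uad) → u₀ ∈ Uad → WeakConv u u₀ →
      F u₀ u₀ ≤ liminf (fun n => F (u n) (u n)) atTop)
    (hF2 : ∀ (u : ℕ → U) (u₀ : U) (v : ℕ → U) (v₀ : U),
      (∀ n, u n ∈ Uad) → u₀ ∈ Uad → WeakConv u u₀ → Tendsto v atTop (𝓝 v₀) →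
      limsup (fun n => F (v n) (u n)) atTop ≤ F v₀ u₀)
    (hG1 : ∀ (u : ℕ → U) (u₀ : U), (∀ n, u n ∈ Uad) → u₀ ∈ Uad → WeakConv u u₀ →
      G (A u₀) u₀ ≤ liminf (fun n => G (A (u n)) (u n)) atTop)
    (hG2 : ∀ (u : ℕ → U) (u₀ : U) (v : ℕ → U) (v₀ : U),
      (∀ n, u n ∈ Uad) → u₀ ∈ Uad → WeakConv u u₀ → Tendsto v atTop (𝓝 v₀) →
      limsup (fun n => G (A (v n)) (u n)) atTop ≤ G (A v₀) u₀)
    -- `H` is proper, convex and lsc (independent of the feedback component)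
    (hHbot : ∀ z, H z ≠ ⊥) (hHproper : ∃ z, H z ≠ ⊤)
    (hHconv : ConvexE H) (hHlsc : LowerSemicontinuous H)
    (γ : ℕ → ℝ) (hγpos : ∀ n, 0 < γ n) (hγ : Tendsto γ atTop atTop) :
    MoscoBiv Uad
      (fun n v u => F v u + G (A v) u + MY (γ n) H (B v))
      (fun v u => F v u + G (A v) u + H (B v)) := by
  refine ⟨?_, ?_⟩
  · intro u x hu hx hw
    have hB : WeakConv (fun n => B (u n)) (B x) := fun f => hw (f.comp B)
    have h3 := aux_MY_liminf hHproper hHbot hHconv hHlsc γ hγpos hγ _ _ hB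
    refine (add_le_add (add_le_add (hF1 u x hu hx hw) (hG1 u x hu hx hw)) h3).trans ?_
    exact (add_le_add_left EReal.le_liminf_add _).trans EReal.le_liminf_add
  · intro u x hu hx hw v hv
    refine ⟨fun _ => v, fun _ => hv, tendsto_const_nhds, ?_⟩
    refine aux_limsup_add ?_ (hHbot _) (aux_limsup_add (hFbot _ _) (hGbot _ _)
      (hF2 u x _ v hu hx hw tendsto_const_nhds) (hG2 u x _ v hu hx hw tendsto_const_nhds)) ?_
    · rw [Ne, EReal.add_eq_bot_iff]
      exact not_or.2 ⟨hFbot _ _, hGbot _ _⟩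
    · exact limsup_le_of_le (by isBoundedDefault) (Eventually.of_forall fun n => aux_MY_le H _ _)
end
end

section
/- Let U be a reflexive Banach space, U_ad ⊆ U nonempty, closed, convex, and E : U_ad × U_ad → ℝ ∪ {+∞} a functional such that for all sequences u_ℓ ⇀ u in U_ad one has E(u,u) ≤ liminf_ℓ E(u_ℓ,u_ℓ), and for all sequences u_ℓ ⇀ u and v_ℓ → v strongly in U_ad one has limsup_ℓ E(v_ℓ,u_ℓ) ≤ E(v,u). Let (U_ℓ) be a sequence of subspaces of U with U_ℓ ⊆ U_{ℓ+1} ⊆ U, U_ad ∩ U_ℓ ≠ ∅, the effective domain of E(·,u_ℓ) nonempty for all u_ℓ ∈ U_ad ∩ U_ℓ and all ℓ, and such that U equals the closure of U_ad ∩ ⋃_ℓ U_ℓ. Define E_ℓ(v,u) := E(v,u) + I_{U_ℓ}(v), where I_{U_ℓ} is the indicator function of U_ℓ (zero on U_ℓ, +∞ elsewhere). Then (E_ℓ) Mosco-converges to E. -/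
open Filter Topology

noncomputable section

open Classical in
/-- Indicator function of a set: `0` on the set and `+∞` elsewhere. -/
def indE {X : Type*} (S : Set X) (x : X) : EReal :=
  if x ∈ S then 0 else ⊤

/-- the functionals `E_ℓ(v,u) = E(v,u) + I_{U_ℓ}(v)` obtained by
restricting `E` to a nested dense sequence of subspaces `U_ℓ` Mosco-converge to
`E`. -/
theorem stmt6 {U : Type*} [NormedAddCommGroup U] [NormedSpace ℝ U] [CompleteSpace U]
    (hrefl : Function.Surjective ⇑(NormedSpace.inclusionInDoubleDual ℝ U))
    (Uad : Set U) (hUne : Uad.Nonempty) (hUcl : IsClosed Uad) (hUconv : Convex ℝ Uad)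
    (E : U → U → EReal) (hEbot : ∀ v u, E v u ≠ ⊥)
    (hE1 : ∀ (u : ℕ → U) (x : U), (∀ ℓ, u ℓ ∈ Uad) → x ∈ Uad → WeakConv u x →
      E x x ≤ liminf (fun ℓ => E (u ℓ) (u ℓ)) atTop)
    (hE2 : ∀ (u : ℕ → U) (x : U) (v : ℕ → U) (v₀ : U),
      (∀ ℓ, u ℓ ∈ Uad) → x ∈ Uad → WeakConv u x → Tendsto v atTop (𝓝 v₀) →
      limsup (fun ℓ => E (v ℓ) (u ℓ)) atTop ≤ E v₀ x)
    (Usub : ℕ → Submodule ℝ U)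
    (hmono : ∀ ℓ, Usub ℓ ≤ Usub (ℓ + 1))
    (hinter : ∀ ℓ, (Uad ∩ (Usub ℓ : Set U)).Nonempty)
    (hdom : ∀ ℓ, ∀ uℓ ∈ Uad ∩ (Usub ℓ : Set U), ∃ v, E v uℓ ≠ ⊤)
    (hdense : closure (Uad ∩ ⋃ ℓ, (Usub ℓ : Set U)) = Set.univ) :
    MoscoBiv Uad (fun ℓ v u => E v u + indE (Usub ℓ : Set U) v) E := by
  have hm : Monotone Usub := monotone_nat_of_le_succ hmono
  refine ⟨?_, ?_⟩
  · intro u x hu hx hw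
    refine (hE1 u x hu hx hw).trans ?_
    refine liminf_le_liminf (Eventually.of_forall fun n => ?_)
    have h0 : (0 : EReal) ≤ indE (Usub n : Set U) (u n) := by
      unfold indE; split_ifs <;> simp
    simpa using add_le_add_right h0 (E (u n) (u n))
  · intro u x hu hx hw v hv
    have hex : ∀ n : ℕ, ∃ y ∈ Uad ∩ (Usub n : Set U),
        dist v y < Metric.infDist v (Uad ∩ (Usub n : Set U)) + 1 / ((n : ℝ) + 1) := by
      intro n
      apply (Metric.infDist_lt_iff (hinter n)).1
      have : (0 : ℝ) < 1 / ((n : ℝ) + 1) := by positivity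
      linarith
    choose w hwm hwd using hex
    have htend : Tendsto w atTop (𝓝 v) := by
      rw [Metric.tendsto_atTop]
      intro ε hε
      have hvc : v ∈ closure (Uad ∩ ⋃ ℓ, (Usub ℓ : Set U)) := by rw [hdense]; trivial
      obtain ⟨y, ⟨hy1, hy2⟩, hyd⟩ := Metric.mem_closure_iff.1 hvc (ε / 2) (by positivity)
      obtain ⟨m, hym⟩ := Set.mem_iUnion.1 hy2
      obtain ⟨k, hk⟩ := exists_nat_one_div_lt (show (0 : ℝ) < ε / 2 by positivity)
      refine ⟨max m k, fun n hn => ?_⟩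
      have h1 : Metric.infDist v (Uad ∩ (Usub n : Set U)) ≤ dist v y :=
        Metric.infDist_le_dist_of_mem ⟨hy1, hm ((le_max_left m k).trans hn) hym⟩
      have h2 : 1 / ((n : ℝ) + 1) ≤ 1 / ((k : ℝ) + 1) :=
        Nat.one_div_le_one_div ((le_max_right m k).trans hn)
      have h3 := hwd n
      rw [dist_comm]
      linarith
    refine ⟨w, fun n => (hwm n).1, htend, ?_⟩
    have h := hE2 u x w v hu hx hw htend
    have he : (fun n => E (w n) (u n) + indE (Usub n : Set U) (w n))
        = fun n => E (w n) (u n) := by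
      funext n
      simp only [indE, if_pos (hwm n).2, add_zero]
    show limsup (fun n => E (w n) (u n) + indE (Usub n : Set U) (w n)) atTop ≤ E v x
    rw [he]
    exact h
end
end

section
/- Let U be a Banach space, U_ad ⊆ U nonempty, closed, convex, and E : U_ad × U_ad → ℝ ∪ {+∞} a functional that is proper, lower semicontinuous and convex in its control (first) component for each fixed second argument. For α > 0 define E_α(v,u) := E(v,u) + (α/2)‖v − u‖_U². Then u ∈ U_ad is an equilibrium of E if and only if u is an equilibrium of E_α. -/
open Filter Topology

noncomputable section

/-- `u` is an equilibrium of `E` iff it is an equilibrium of the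
strongly convexified functional `E_α(v,u) = E(v,u) + (α/2)‖v − u‖²`. -/
theorem stmt11 {U : Type*} [NormedAddCommGroup U] [NormedSpace ℝ U]
    (Uad : Set U) (hUne : Uad.Nonempty) (hUcl : IsClosed Uad) (hUconv : Convex ℝ Uad)
    (E : U → U → EReal)
    -- `E(·,u)` is proper, lsc and convex in the control component for each `u ∈ U_ad`
    (hEbot : ∀ v u, E v u ≠ ⊥)
    (hproper : ∀ u ∈ Uad, ∃ v ∈ Uad, E v u ≠ ⊤)
    (hlsc : ∀ u ∈ Uad, LowerSemicontinuous fun v => E v u)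
    (hconv : ∀ u ∈ Uad, ∀ x ∈ Uad, ∀ y ∈ Uad, ∀ t : ℝ, 0 ≤ t → t ≤ 1 →
      E (t • x + (1 - t) • y) u ≤ (t : EReal) * E x u + ((1 - t : ℝ) : EReal) * E y u)
    (α : ℝ) (hα : 0 < α) (u : U) :
    IsEquilibrium Uad E u ↔
      IsEquilibrium Uad
        (fun v u => E v u + ((α / 2 * ‖v - u‖ ^ 2 : ℝ) : EReal)) u := by
  constructor
  · rintro ⟨hu, h⟩
    refine ⟨hu, fun v hv => ?_⟩
    have h0 : (0 : EReal) ≤ ((α / 2 * ‖v - u‖ ^ 2 : ℝ) : EReal) := by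
      exact_mod_cast (by positivity : (0 : ℝ) ≤ α / 2 * ‖v - u‖ ^ 2)
    simpa using add_le_add (h v hv) h0
  · rintro ⟨hu, h⟩
    refine ⟨hu, fun v hv => ?_⟩
    simp only [sub_self, norm_zero] at h
    have htop : E u u ≠ ⊤ := by
      obtain ⟨w, hw, hwt⟩ := hproper u hu
      have h1 := h w hw
      intro hc
      rw [hc] at h1
      lift E w u to ℝ using ⟨hwt, hEbot w u⟩ with r
      rw [EReal.top_add_coe, ← EReal.coe_add, top_le_iff] at h1
      exact EReal.coe_ne_top _ h1
    by_cases hvt : E v u = ⊤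
    · rw [hvt]; exact le_top
    have key : ∀ t : ℝ, 0 ≤ t → t ≤ 1 →
        E u u ≤ (t : EReal) * E v u + ((1 - t : ℝ) : EReal) * E u u
          + ((α / 2 * (t * ‖v - u‖) ^ 2 : ℝ) : EReal) := by
      intro t ht0 ht1
      have h1 := h (t • v + (1 - t) • u)
        (hUconv hv hu ht0 (by linarith) (by ring))
      have e : t • v + (1 - t) • u - u = t • (v - u) := by module
      rw [e, norm_smul, Real.norm_of_nonneg ht0] at h1
      have h2 := hconv u hu v hv u hu t ht0 ht1
      refine le_trans ?_ (h1.trans (add_le_add h2 le_rfl))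
      simp
    lift E u u to ℝ using ⟨htop, hEbot u u⟩ with a
    lift E v u to ℝ using ⟨hvt, hEbot v u⟩ with b
    norm_cast at key ⊢
    by_contra! hlt
    set K := α / 2 * ‖v - u‖ ^ 2 with hK
    have hK0 : 0 ≤ K := by positivity
    have hd : 0 < a - b := by linarith
    have hs : 0 < a - b + K := by linarith
    set t := (a - b) / (a - b + K) with ht
    have htp : 0 < t := by positivity
    have hts : t * (a - b + K) = a - b := by rw [ht]; field_simp
    have h3 := key t htp.le (by rw [ht, div_le_one hs]; linarith)
    have h4 : t * (a - b) ≤ t * (t * K) := by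
      rw [hK]; nlinarith
    have h5 := le_of_mul_le_mul_left h4 htp
    have : 0 < t * (a - b) := by positivity
    nlinarith
end
end

section
/- Let U be a Banach space, U_ad ⊆ U nonempty, closed, convex, and E : U_ad × U_ad → ℝ ∪ {+∞} such that for every u ∈ U_ad the functional E(·,u) is proper, lower semicontinuous, α-strongly convex for some fixed α > 0, and attains its minimum over U_ad at B(u). Let P be a set and D : P × U_ad → ℝ ∪ {+∞} a dual functional of E, i.e. 0 ≤ E(v,u) + D(p,u) for all v, u ∈ U_ad and p ∈ P. Then for all u ∈ U_ad and all p ∈ P one has (α/2)‖u − B(u)‖_U² ≤ E(u,u) + D(p,u). -/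
open Filter Topology

noncomputable section

/-- a posteriori estimate from a dual functional. If `E(·,u)` is
proper, lsc and `α`-strongly convex with minimizer `B(u)` over `U_ad`, and `D` is a
dual functional of `E` (`0 ≤ E(v,u) + D(p,u)` for all `v,u ∈ U_ad`, `p ∈ P`), then
`(α/2)‖u − B(u)‖² ≤ E(u,u) + D(p,u)` for all `u ∈ U_ad` and `p ∈ P`. -/
theorem stmt13 {U : Type*} [NormedAddCommGroup U] [NormedSpace ℝ U]
    (Uad : Set U) (hUne : Uad.Nonempty) (hUcl : IsClosed Uad) (hUconv : Convex ℝ Uad)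
    (E : U → U → EReal) (α : ℝ) (hα : 0 < α)
    (hEbot : ∀ v u, E v u ≠ ⊥)
    (hproper : ∀ u ∈ Uad, ∃ v ∈ Uad, E v u ≠ ⊤)
    (hlsc : ∀ u ∈ Uad, LowerSemicontinuous fun v => E v u)
    (hsconv : ∀ u ∈ Uad, ∀ x ∈ Uad, ∀ y ∈ Uad, ∀ t : ℝ, 0 ≤ t → t ≤ 1 →
      E (t • x + (1 - t) • y) u ≤ (t : EReal) * E x u + ((1 - t : ℝ) : EReal) * E y u
        - ((α / 2 * (t * (1 - t)) * ‖x - y‖ ^ 2 : ℝ) : EReal))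
    (B : U → U) (hB : ∀ u ∈ Uad, B u ∈ Uad ∧ ∀ v ∈ Uad, E (B u) u ≤ E v u)
    {P : Type*} (D : P → U → EReal)
    (hdual : ∀ v ∈ Uad, ∀ u ∈ Uad, ∀ p : P, 0 ≤ E v u + D p u) :
    ∀ u ∈ Uad, ∀ p : P,
      ((α / 2 * ‖u - B u‖ ^ 2 : ℝ) : EReal) ≤ E u u + D p u := by
  intro u hu p
  obtain ⟨hBu, hmin⟩ := hB u hu
  have h0 := hdual (B u) hBu u hu p
  have hs := hsconv u hu u hu (B u) hBu
  have hm : ∀ t : ℝ, 0 ≤ t → t ≤ 1 → E (B u) u ≤ E (t • u + (1 - t) • B u) u :=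
    fun t h1 h2 => hmin _ (hUconv hu hBu h1 (by linarith) (by ring))
  have hle := hmin u hu
  have hb1 := hEbot u u
  have hb2 := hEbot (B u) u
  generalize D p u = d at *
  generalize hN : ‖u - B u‖ ^ 2 = N at *
  have hN0 : 0 ≤ N := by rw [← hN]; positivity
  generalize E u u = e at *
  generalize E (B u) u = b at *
  induction d with
  | bot => simp at h0
  | top => rw [EReal.add_top_of_ne_bot hb1]; exact le_top
  | coe d =>
    induction e with
    | bot => exact absurd rfl hb1
    | top => rw [EReal.top_add_coe]; exact le_top
    | coe e =>
      induction b with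
      | bot => exact absurd rfl hb2
      | top => simp at hle
      | coe b =>
        have key : ∀ t : ℝ, 0 ≤ t → t ≤ 1 →
            b ≤ t * e + (1 - t) * b - α / 2 * (t * (1 - t)) * N := fun t h1 h2 => by
          have := (hm t h1 h2).trans (hs t h1 h2)
          exact_mod_cast this
        have h0' : 0 ≤ b + d := by exact_mod_cast h0
        have hle' : b ≤ e := by exact_mod_cast hle
        have goal : α / 2 * N ≤ e + d := by
          suffices h : α / 2 * N ≤ e - b by linarith
          by_contra hcon
          push Not at hcon
          obtain ⟨c, hc⟩ : ∃ c, c = α / 2 * N := ⟨_, rfl⟩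
          rw [← hc] at hcon
          have hc0 : 0 < c := by linarith
          obtain ⟨t, ht⟩ : ∃ t, t = (c - (e - b)) / (2 * c) := ⟨_, rfl⟩
          have htc : t * c = (c - (e - b)) / 2 := by rw [ht]; field_simp
          have ht0 : 0 < t := by rw [ht]; apply div_pos <;> linarith
          have ht1 : t ≤ 1 := by
            rw [ht, div_le_one (by linarith)]; linarith
          have hk := key t ht0.le ht1
          have h2 : 0 ≤ t * ((e - b) - (c - t * c)) := by
            have : α / 2 * (t * (1 - t)) * N = t * (c - t * c) := by rw [hc]; ring
            linarith
          have h3 := nonneg_of_mul_nonneg_right h2 ht0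
          linarith
        exact_mod_cast goal
end
end

section
/- Let Ω ⊆ ℝ^d be an open bounded set with Lebesgue measure, U a reflexive Banach space, i : U → L²(Ω) a compact bounded linear operator, and Φ : U → U weakly sequentially continuous (u_n ⇀ u implies Φ(u_n) ⇀ Φ(u)). For u ∈ U define K(u) := { z ∈ L²(Ω) : z ≥ i(Φ(u)) almost everywhere on Ω }. Then: (a) if z_n ⇀ z in L²(Ω), u_n ⇀ u in U, and z_n ∈ K(u_n) for all n, then z ∈ K(u); and (b) for every sequence u_n ⇀ u in U and every z ∈ K(u), the sequence z_n := z − i(Φ(u)) + i(Φ(u_n)) satisfies z_n ∈ K(u_n) for all n and z_n → z strongly in L²(Ω). -/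
open MeasureTheory Filter Topology

noncomputable section

theorem WeakConv.bdd {U : Type*} [NormedAddCommGroup U] [NormedSpace ℝ U]
    {u : ℕ → U} {x : U} (h : WeakConv u x) : ∃ C, ∀ n, ‖u n‖ ≤ C := by
  obtain ⟨C, hC⟩ := banach_steinhaus
    (g := fun n => NormedSpace.inclusionInDoubleDual ℝ U (u n)) (fun f => by
      obtain ⟨C, hC⟩ := (Metric.isBounded_range_of_tendsto _ (h f)).exists_norm_le
      exact ⟨C, fun n => hC _ ⟨n, rfl⟩⟩)
  refine ⟨C, fun n => ?_⟩
  have := hC n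
  rwa [show ‖NormedSpace.inclusionInDoubleDual ℝ U (u n)‖ = ‖u n‖ from
    (NormedSpace.inclusionInDoubleDualLi ℝ).norm_map (u n)] at this

theorem WeakConv.compact {U V : Type*} [NormedAddCommGroup U] [NormedSpace ℝ U]
    [NormedAddCommGroup V] [NormedSpace ℝ V]
    {u : ℕ → U} {x : U} (h : WeakConv u x) (i : U →L[ℝ] V) (hi : IsCompactOperator i) :
    Tendsto (fun n => i (u n)) atTop (𝓝 (i x)) := by
  obtain ⟨C, hC⟩ := h.bdd
  obtain ⟨K, hK, hKs⟩ := hi.image_closedBall_subset_compact C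
  refine hK.tendsto_nhds_of_unique_mapClusterPt (Eventually.of_forall fun n => hKs ⟨u n, ?_, rfl⟩) ?_
  · simpa using hC n
  · intro y _ hy
    refine (SeparatingDual.eq_iff_forall_dual_eq (R := ℝ)).2 fun f => ?_
    have h1 : MapClusterPt (f y) atTop (fun n => f (i (u n))) :=
      hy.continuousAt_comp f.continuous.continuousAt
    have h2 := h (f.comp i)
    exact eq_of_nhds_neBot (h1.neBot.mono (inf_le_inf_left _ h2))

/-- for a compact embedding `i : U → L²(Ω)` and a weakly sequentially
continuous obstacle map `Φ : U → U`, the moving constraint sets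
`K(u) = { z ∈ L²(Ω) : z ≥ i(Φ(u)) a.e. }` are (a) weakly sequentially closed in the
appropriate joint sense and (b) admit strong recovery sequences of the form
`z_n = z − i(Φ(u)) + i(Φ(u_n))`. -/
theorem stmt15 {d : ℕ} (Ω : Set (Fin d → ℝ))
    (hΩo : IsOpen Ω) (hΩb : Bornology.IsBounded Ω)
    {U : Type*} [NormedAddCommGroup U] [NormedSpace ℝ U] [CompleteSpace U]
    (hrefl : Function.Surjective ⇑(NormedSpace.inclusionInDoubleDual ℝ U))
    (i : U →L[ℝ] Lp ℝ 2 (volume.restrict Ω)) (hi : IsCompactOperator i)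
    (Φ : U → U)
    (hΦ : ∀ (u : ℕ → U) (u₀ : U), WeakConv u u₀ → WeakConv (fun n => Φ (u n)) (Φ u₀)) :
    -- (a) weak sequential closedness
    (∀ (z : ℕ → Lp ℝ 2 (volume.restrict Ω)) (z₀ : Lp ℝ 2 (volume.restrict Ω))
        (u : ℕ → U) (u₀ : U),
      WeakConv z z₀ → WeakConv u u₀ →
      (∀ n, ∀ᵐ x ∂(volume.restrict Ω), (i (Φ (u n))) x ≤ (z n) x) →
      (∀ᵐ x ∂(volume.restrict Ω), (i (Φ u₀)) x ≤ z₀ x)) ∧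
    -- (b) strong recovery sequences
    (∀ (u : ℕ → U) (u₀ : U), WeakConv u u₀ →
      ∀ z₀ : Lp ℝ 2 (volume.restrict Ω),
      (∀ᵐ x ∂(volume.restrict Ω), (i (Φ u₀)) x ≤ z₀ x) →
      (∀ n, ∀ᵐ x ∂(volume.restrict Ω),
        (i (Φ (u n))) x ≤ (z₀ - i (Φ u₀) + i (Φ (u n))) x) ∧
      Tendsto (fun n => z₀ - i (Φ u₀) + i (Φ (u n))) atTop (𝓝 z₀)) := by
  constructor
  · intro z z₀ u u₀ hz hu hle
    have hw : WeakConv (fun n => z n - i (Φ (u n))) (z₀ - i (Φ u₀)) := by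
      intro f
      simpa using (hz f).sub (hΦ u u₀ hu (f.comp i))
    have hn : ∀ n, z n - i (Φ (u n)) ∈ Set.Ici (0 : Lp ℝ 2 (volume.restrict Ω)) := fun n =>
      sub_nonneg.2 ((Lp.coeFn_le _ _).1 (hle n))
    have hconv : Convex ℝ (Set.Ici (0 : Lp ℝ 2 (volume.restrict Ω))) := by
      intro x hx y hy a b ha hb _
      have key : ∀ (c : ℝ) (w : Lp ℝ 2 (volume.restrict Ω)), 0 ≤ c → 0 ≤ w → 0 ≤ c • w := by
        intro c w hc hw
        rw [← Lp.coeFn_nonneg] at hw ⊢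
        filter_upwards [hw, Lp.coeFn_smul c w] with t ht hs
        rw [hs]
        exact mul_nonneg hc ht
      exact add_nonneg (key a x ha hx) (key b y hb hy)
    refine (Lp.coeFn_le _ _).2 (sub_nonneg.1 ?_)
    by_contra hcon
    obtain ⟨f, c, hf, hc⟩ := geometric_hahn_banach_closed_point hconv isClosed_Ici hcon
    exact absurd (le_of_tendsto' (hw f) fun n => (hf _ (hn n)).le) (not_le.2 hc)
  · intro u u₀ hu z₀ hz
    refine ⟨fun n => ?_, ?_⟩
    · refine (Lp.coeFn_le _ _).2 ?_
      have := sub_nonneg.2 ((Lp.coeFn_le _ _).1 hz)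
      exact le_add_of_nonneg_left this
    · have := ((hΦ u u₀ hu).compact i hi).const_add (z₀ - i (Φ u₀))
      simpa using this
end
end

section
/- Let X be a reflexive Banach space and let f, π, ρ : X → ℝ ∪ {+∞} be convex, proper, lower semicontinuous functionals with f subdifferentiable (∂f(x) ≠ ∅ for all x ∈ X), dom π = dom ρ = X, π and ρ continuous, and ρ α-strongly convex for some α > 0. For γ > 0 define v(γ) := inf_{x ∈ X} ( f(x) + γ π(x) + (1/γ) ρ(x) ), and assume for each γ > 0 the infimum is attained at the (unique) minimizer x_γ. Then v : (0,∞) → ℝ is differentiable and v'(γ) = π(x_γ) − (1/γ²) ρ(x_γ). -/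
open Filter Topology

noncomputable section

lemma aux_lower {X : Type*} [NormedAddCommGroup X] [NormedSpace ℝ X]
    (h : X → ℝ) (hc : ConvexOn ℝ Set.univ h) (hcont : Continuous h) (x0 : X) :
    ∃ L : ℝ, 0 ≤ L ∧ ∀ x, -(L * ‖x - x0‖) ≤ h x - h x0 := by
  have h1 : ∀ᶠ y in 𝓝 x0, h y < h x0 + 1 :=
    hcont.continuousAt.eventually (gt_mem_nhds (by linarith))
  obtain ⟨r, hr, hball⟩ := Metric.eventually_nhds_iff.1 h1
  refine ⟨2 / r, by positivity, fun x => ?_⟩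
  by_cases hx : x = x0
  · simp [hx]
  have hd : 0 < ‖x - x0‖ := norm_pos_iff.2 (sub_ne_zero.2 hx)
  set d := ‖x - x0‖ with hdd
  set s : ℝ := r / (2 * d) with hs
  have hs0 : 0 < s := by positivity
  have hy : h (x0 - s • (x - x0)) < h x0 + 1 := by
    apply hball
    rw [dist_eq_norm]
    have : x0 - s • (x - x0) - x0 = -(s • (x - x0)) := by abel
    rw [this, norm_neg, norm_smul, Real.norm_of_nonneg hs0.le, ← hdd]
    have : s * d = r / 2 := by rw [hs]; field_simp
    linarith
  have h2 := hc.2 (Set.mem_univ x) (Set.mem_univ (x0 - s • (x - x0)))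
    (show 0 ≤ s / (1 + s) by positivity) (show 0 ≤ 1 / (1 + s) by positivity)
    (by field_simp; ring)
  have h3 : (s / (1 + s)) • x + (1 / (1 + s)) • (x0 - s • (x - x0)) = x0 := by
    have hne : 1 + s ≠ 0 := by positivity
    match_scalars <;> field_simp <;> ring
  rw [h3] at h2
  simp only [smul_eq_mul] at h2
  have h4 : (1 + s) * h x0 ≤ s * h x + h (x0 - s • (x - x0)) := by
    have := mul_le_mul_of_nonneg_left h2 (show 0 ≤ 1 + s by positivity)
    refine this.trans (le_of_eq ?_)
    field_simp
  have h5 : -1 ≤ s * (h x - h x0) := by nlinarith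
  have h6 : 2 / r * d = 1 / s := by rw [hs]; field_simp
  rw [h6]
  have : -(1 / s) = (-1) / s := by ring
  rw [this, div_le_iff₀ hs0]
  linarith

lemma aux_est (γ₀ : ℝ) (hγ₀ : 0 < γ₀) (L c : ℝ) (hL : 0 ≤ L) (hc : 0 < c) :
    ∃ C : ℝ, ∀ γ G P R d : ℝ, γ₀ / 2 < γ → γ < 2 * γ₀ → 0 ≤ d →
      -(L * d) ≤ G → -(L * d) ≤ P → -(L * d) ≤ R →
      G + γ * P + 1 / γ * R ≤ 0 → c * d ^ 2 ≤ G + γ₀ * P + 1 / γ₀ * R →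
      |G + γ * P + 1 / γ * R| ≤ C * (γ - γ₀) ^ 2 := by
  set K : ℝ := L * (1 + (1 + 2 / γ₀) * (2 / γ₀) + 2 * γ₀ * (1 + 2 * γ₀)) with hK
  set Q : ℝ := (1 + 2 / γ₀ ^ 2) * K with hQ
  have hK0 : 0 ≤ K := by positivity
  have hQ0 : 0 ≤ Q := by positivity
  refine ⟨Q ^ 2 / c, fun γ G P R d h1 h2 hd hG hP hR hE hS => ?_⟩
  have hγ : 0 < γ := by linarith
  have hinv : 1 / γ ≤ 2 / γ₀ := by
    rw [div_le_div_iff₀ hγ hγ₀]; linarith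
  have hinv0 : 0 < 1 / γ := by positivity
  have hLd : 0 ≤ L * d := by positivity
  have hPK : |P| ≤ K * d := by
    have a1 : γ * P ≤ L * d * (1 + 1 / γ) := by nlinarith
    have a2 : P ≤ L * d * (1 + 1 / γ) * (1 / γ) := by
      rw [mul_one_div, le_div_iff₀ hγ]; linarith
    have a3 : (1 + 1 / γ) * (1 / γ) ≤ (1 + 2 / γ₀) * (2 / γ₀) := by gcongr
    have a4 : P ≤ L * d * ((1 + 2 / γ₀) * (2 / γ₀)) := by
      have := mul_le_mul_of_nonneg_left a3 hLd
      linarith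
    have e1 : 0 ≤ L * d * ((1 + 2 / γ₀) * (2 / γ₀)) := by positivity
    have e2 : 0 ≤ L * d * (2 * γ₀ * (1 + 2 * γ₀)) := by positivity
    have e3 : K * d = L * d + L * d * ((1 + 2 / γ₀) * (2 / γ₀))
      + L * d * (2 * γ₀ * (1 + 2 * γ₀)) := by rw [hK]; ring
    rw [abs_le]; constructor <;> linarith
  have hRK : |R| ≤ K * d := by
    have a1 : 1 / γ * R ≤ L * d * (1 + γ) := by nlinarith
    have a2 : R ≤ L * d * (1 + γ) * γ := by
      have := mul_le_mul_of_nonneg_right a1 hγ.le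
      have e : 1 / γ * R * γ = R := by field_simp
      linarith
    have a3 : γ * (1 + γ) ≤ 2 * γ₀ * (1 + 2 * γ₀) := by gcongr
    have a4 : R ≤ L * d * (2 * γ₀ * (1 + 2 * γ₀)) := by
      have := mul_le_mul_of_nonneg_left a3 hLd
      linarith
    have e1 : 0 ≤ L * d * ((1 + 2 / γ₀) * (2 / γ₀)) := by positivity
    have e2 : 0 ≤ L * d * (2 * γ₀ * (1 + 2 * γ₀)) := by positivity
    have e3 : K * d = L * d + L * d * ((1 + 2 / γ₀) * (2 / γ₀))
      + L * d * (2 * γ₀ * (1 + 2 * γ₀)) := by rw [hK]; ring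
    rw [abs_le]; constructor <;> linarith
  have hdiff : |1 / γ - 1 / γ₀| ≤ |γ - γ₀| * (2 / γ₀ ^ 2) := by
    have e : 1 / γ - 1 / γ₀ = -((γ - γ₀) * (1 / γ * (1 / γ₀))) := by field_simp; ring
    rw [e, abs_neg, abs_mul, abs_of_pos (show 0 < 1 / γ * (1 / γ₀) by positivity)]
    have e' : 2 / γ₀ ^ 2 = 2 / γ₀ * (1 / γ₀) := by field_simp
    rw [e']
    gcongr
  have hT : |(γ - γ₀) * P + (1 / γ - 1 / γ₀) * R| ≤ |γ - γ₀| * Q * d := by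
    calc _ ≤ |γ - γ₀| * |P| + |1 / γ - 1 / γ₀| * |R| := by
            rw [← abs_mul, ← abs_mul]; exact abs_add_le _ _
      _ ≤ |γ - γ₀| * (K * d) + (|γ - γ₀| * (2 / γ₀ ^ 2)) * (K * d) := by gcongr
      _ = _ := by rw [hQ]; ring
  have hT' := abs_le.1 hT
  have hd2 : c * d ^ 2 ≤ |γ - γ₀| * Q * d := by linarith [hT'.1]
  have hdδ : d ≤ |γ - γ₀| * Q / c := by
    rw [le_div_iff₀ hc]
    rcases hd.eq_or_lt with h | h
    · rw [← h]; simp; positivity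
    · nlinarith
  have hfin : |γ - γ₀| * Q * d ≤ Q ^ 2 / c * (γ - γ₀) ^ 2 := by
    calc _ ≤ |γ - γ₀| * Q * (|γ - γ₀| * Q / c) := by gcongr
      _ = Q ^ 2 / c * |γ - γ₀| ^ 2 := by ring
      _ = _ := by rw [sq_abs]
  rw [abs_of_nonpos hE]
  have : 0 ≤ c * d ^ 2 := by positivity
  linarith [hT'.1]

/-- differentiability of the value function
`v(γ) = inf_x ( f(x) + γ π(x) + (1/γ) ρ(x) )` with derivative
`v'(γ) = π(x_γ) − (1/γ²) ρ(x_γ)` at the minimizer `x_γ`. The functionals `π, ρ` are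
real-valued (their effective domain is all of `X`), continuous and convex, `ρ` is
`α`-strongly convex, and `f` is proper, convex, lsc and everywhere
subdifferentiable. -/
theorem stmt16 {X : Type*} [NormedAddCommGroup X] [NormedSpace ℝ X] [CompleteSpace X]
    (hrefl : Function.Surjective ⇑(NormedSpace.inclusionInDoubleDual ℝ X))
    (f : X → EReal)
    (hfbot : ∀ x, f x ≠ ⊥) (hfproper : ∃ x, f x ≠ ⊤)
    (hfconv : ConvexE f) (hflsc : LowerSemicontinuous f)
    (hfsub : ∀ x : X, ∃ x' : X →L[ℝ] ℝ,
      ∀ y : X, f x + ((x' y - x' x : ℝ) : EReal) ≤ f y)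
    (pi rho : X → ℝ)
    (hpiconv : ConvexOn ℝ Set.univ pi) (hpicont : Continuous pi)
    (hrhoconv : ConvexOn ℝ Set.univ rho) (hrhocont : Continuous rho)
    (α : ℝ) (hα : 0 < α)
    (hrhosc : ∀ x y : X, ∀ t : ℝ, 0 ≤ t → t ≤ 1 →
      rho (t • x + (1 - t) • y) ≤
        t * rho x + (1 - t) * rho y - α / 2 * (t * (1 - t)) * ‖x - y‖ ^ 2)
    (xmin : ℝ → X)
    (hmin : ∀ γ : ℝ, 0 < γ → ∀ x : X,
      f (xmin γ) + ((γ * pi (xmin γ) + (1 / γ) * rho (xmin γ) : ℝ) : EReal) ≤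
        f x + ((γ * pi x + (1 / γ) * rho x : ℝ) : EReal)) :
    ∃ vr : ℝ → ℝ,
      (∀ γ : ℝ, 0 < γ →
        (⨅ x : X, f x + ((γ * pi x + (1 / γ) * rho x : ℝ) : EReal)) = (vr γ : EReal)) ∧
      (∀ γ : ℝ, 0 < γ →
        HasDerivAt vr (pi (xmin γ) - (1 / γ ^ 2) * rho (xmin γ)) γ) := by
  have hftop : ∀ x, f x ≠ ⊤ := by
    intro x hx
    obtain ⟨y, hy⟩ := hfproper
    obtain ⟨x', hx'⟩ := hfsub x
    have := hx' y
    rw [hx, EReal.top_add_coe, top_le_iff] at this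
    exact hy this
  obtain ⟨g, rfl⟩ : ∃ g : X → ℝ, f = fun x => ((g x : ℝ) : EReal) :=
    ⟨fun x => (f x).toReal, funext fun x => (EReal.coe_toReal (hftop x) (hfbot x)).symm⟩
  have hmin' : ∀ γ : ℝ, 0 < γ → ∀ x : X,
      g (xmin γ) + (γ * pi (xmin γ) + (1 / γ) * rho (xmin γ)) ≤
        g x + (γ * pi x + (1 / γ) * rho x) := fun γ hγ x => by
    have := hmin γ hγ x
    beta_reduce at this
    exact_mod_cast this
  have hgmid : ∀ (x y : X) (t : ℝ), 0 ≤ t → t ≤ 1 → g (t • x + (1 - t) • y) ≤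
      t * g x + (1 - t) * g y := fun x y t h0 h1 => by
    have := hfconv x y t h0 h1
    beta_reduce at this
    exact_mod_cast this
  refine ⟨fun γ => g (xmin γ) + (γ * pi (xmin γ) + (1 / γ) * rho (xmin γ)), ?_, ?_⟩
  · intro γ hγ
    apply le_antisymm
    · refine (iInf_le _ (xmin γ)).trans (le_of_eq ?_)
      push_cast
      rfl
    · refine le_iInf fun x => ?_
      beta_reduce
      exact_mod_cast hmin' γ hγ x
  intro γ₀ hγ₀
  set x0 := xmin γ₀ with hx0
  obtain ⟨L1, hL1, hP⟩ := aux_lower pi hpiconv hpicont x0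
  obtain ⟨L2, hL2, hR⟩ := aux_lower rho hrhoconv hrhocont x0
  obtain ⟨x', hx'⟩ := hfsub x0
  have hG : ∀ x, -(‖x'‖ * ‖x - x0‖) ≤ g x - g x0 := fun x => by
    have h1 : g x0 + (x' x - x' x0) ≤ g x := by
      have := hx' x
      beta_reduce at this
      exact_mod_cast this
    have h2 := x'.le_opNorm (x - x0)
    rw [map_sub, Real.norm_eq_abs] at h2
    linarith [(abs_le.1 h2).1]
  have hc : 0 < α / (4 * γ₀) := by positivity
  obtain ⟨C, hC⟩ := aux_est γ₀ hγ₀ (L1 + L2 + ‖x'‖) (α / (4 * γ₀)) (by positivity) hc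
  have hgrow : ∀ x, α / (4 * γ₀) * ‖x - x0‖ ^ 2 ≤
      (g x - g x0) + γ₀ * (pi x - pi x0) + 1 / γ₀ * (rho x - rho x0) := fun x => by
    have h0 := hmin' γ₀ hγ₀ ((1 / 2 : ℝ) • x + (1 - 1 / 2 : ℝ) • x0)
    rw [← hx0] at h0
    have h1 := hgmid x x0 (1 / 2) (by norm_num) (by norm_num)
    have h2 := hpiconv.2 (Set.mem_univ x) (Set.mem_univ x0)
      (show (0 : ℝ) ≤ 1 / 2 by norm_num) (show (0 : ℝ) ≤ 1 - 1 / 2 by norm_num) (by norm_num)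
    simp only [smul_eq_mul] at h2
    have h3 := hrhosc x x0 (1 / 2) (by norm_num) (by norm_num)
    have h2' := mul_le_mul_of_nonneg_left h2 hγ₀.le
    have h3' := mul_le_mul_of_nonneg_left h3 (show 0 ≤ 1 / γ₀ by positivity)
    have e : α / (4 * γ₀) * ‖x - x0‖ ^ 2 =
      2 * (1 / γ₀ * (α / 2 * (1 / 2 * (1 - 1 / 2)) * ‖x - x0‖ ^ 2)) := by
      field_simp; ring
    rw [e]
    linarith
  set E : ℝ → ℝ := fun γ => (g (xmin γ) - g x0) + γ * (pi (xmin γ) - pi x0)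
    + 1 / γ * (rho (xmin γ) - rho x0) with hE
  have hEb : ∀ᶠ γ in 𝓝 γ₀, ‖E γ‖ ≤ C * ‖(γ - γ₀) ^ 2‖ := by
    filter_upwards [lt_mem_nhds (show γ₀ / 2 < γ₀ by linarith),
      gt_mem_nhds (show γ₀ < 2 * γ₀ by linarith)] with γ h1 h2
    have hγ : 0 < γ := by linarith
    rw [Real.norm_eq_abs, Real.norm_of_nonneg (sq_nonneg _)]
    have n1 : 0 ≤ L1 * ‖xmin γ - x0‖ := by positivity
    have n2 : 0 ≤ L2 * ‖xmin γ - x0‖ := by positivity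
    have n3 : 0 ≤ ‖x'‖ * ‖xmin γ - x0‖ := by positivity
    refine hC γ _ _ _ ‖xmin γ - x0‖ h1 h2 (norm_nonneg _) ?_ ?_ ?_ ?_ (hgrow _)
    · linarith [hG (xmin γ)]
    · linarith [hP (xmin γ)]
    · linarith [hR (xmin γ)]
    · linarith [hmin' γ hγ x0]
  have hE0 : E γ₀ = 0 := by simp [hE, ← hx0]
  have hEd : HasDerivAt E 0 γ₀ := by
    rw [hasDerivAt_iff_isLittleO]
    simp only [hE0, smul_zero, sub_zero]
    refine (Asymptotics.IsBigO.of_bound C hEb).trans_isLittleO ?_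
    simpa only [Real.norm_eq_abs, sq_abs] using
      Asymptotics.isLittleO_pow_sub_sub γ₀ (m := 2) (by norm_num)
  have hA : HasDerivAt (fun γ : ℝ => g x0 + (γ * pi x0 + γ⁻¹ * rho x0))
      (1 * pi x0 + -(γ₀ ^ 2)⁻¹ * rho x0) γ₀ :=
    (((hasDerivAt_id γ₀).mul_const _).add ((hasDerivAt_inv hγ₀.ne').mul_const _)).const_add _
  have hfun : (fun γ : ℝ => g (xmin γ) + (γ * pi (xmin γ) + (1 / γ) * rho (xmin γ))) =
      (fun γ : ℝ => g x0 + (γ * pi x0 + γ⁻¹ * rho x0)) + E := by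
    funext γ
    simp only [hE, Pi.add_apply, one_div]
    ring
  have hval : pi x0 - (1 / γ₀ ^ 2) * rho x0 = (1 * pi x0 + -(γ₀ ^ 2)⁻¹ * rho x0) + 0 := by
    rw [one_div]; ring
  rw [hfun, hval]
  exact hA.add hEd
end
end
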